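/- Let u be a smooth strictly convex function on a bounded open convex set P ⊂ ℝⁿ and let H = (Hess u)^{-1} extend smoothly to the closure of P. Then the operator Δᵘ f = Σ_{i,j} (H_{ij} ∂²f/∂xᵢ∂xⱼ + (∂H_{ij}/∂xⱼ) ∂f/∂xᵢ) satisfies the integration-by-parts identity ∫_P h Δᵘf dx = −∫_P Σ_{i,j} H_{ij} (∂f/∂xᵢ)(∂h/∂xⱼ) dx for all f,h ∈ C²(closure P), provided H satisfies the boundary condition H(νₖ,·) = 0 on each facet Fₖ with inward normal νₖ. Consequently Δᵘ is symmetric and its kernel in C²(closure P) consists exactly of the constant functions. -/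

import Mathlib

open MeasureTheory Matrix

section Polytope

open Set Filter Topology

variable {n : ℕ} {ι : Type*}

/-- The open polyhedron cut out by the affine inequalities with labels in `S`. -/
def openPolyhedron (S : Finset ι) (ν : ι → Fin n → ℝ) (c : ι → ℝ) : Set (Fin n → ℝ) :=
  {x | ∀ k ∈ S, 0 < ν k ⬝ᵥ x + c k}

lemma contDiff_dotProduct_add_const {m : WithTop ℕ∞} (w : Fin n → ℝ) (b : ℝ) :
    ContDiff ℝ m (fun x : Fin n → ℝ => w ⬝ᵥ x + b) := by
  unfold dotProduct
  fun_prop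

lemma continuous_dotProduct_add_const (w : Fin n → ℝ) (b : ℝ) :
    Continuous (fun x : Fin n → ℝ => w ⬝ᵥ x + b) :=
  (contDiff_dotProduct_add_const (m := 0) w b).continuous

lemma fderiv_dotProduct_add_const_single (w : Fin n → ℝ) (b : ℝ) (x : Fin n → ℝ) (j : Fin n) :
    fderiv ℝ (fun x : Fin n → ℝ => w ⬝ᵥ x + b) x (Pi.single j 1) = w j := by
  have h : HasFDerivAt (fun x : Fin n → ℝ => w ⬝ᵥ x + b)
      (∑ i, w i • (ContinuousLinearMap.proj i : (Fin n → ℝ) →L[ℝ] ℝ)) x := by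
    have := (∑ i, w i • (ContinuousLinearMap.proj i : (Fin n → ℝ) →L[ℝ] ℝ)).hasFDerivAt (x := x)
    refine (this.add_const b).congr_of_eventuallyEq (.of_forall fun y => ?_)
    simp [dotProduct]
  rw [h.fderiv]
  simp [Pi.single_apply]

lemma dotProduct_lineMap_add_const (w x q : Fin n → ℝ) (b t : ℝ) :
    w ⬝ᵥ AffineMap.lineMap x q t + b = (1 - t) * (w ⬝ᵥ x + b) + t * (w ⬝ᵥ q + b) := by
  rw [AffineMap.lineMap_apply_module, dotProduct_add, dotProduct_smul, dotProduct_smul]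
  simp only [smul_eq_mul]
  ring

lemma isOpen_openPolyhedron (S : Finset ι) (ν : ι → Fin n → ℝ) (c : ι → ℝ) :
    IsOpen (openPolyhedron S ν c) := by
  have : openPolyhedron S ν c = ⋂ k ∈ S, {x | 0 < ν k ⬝ᵥ x + c k} := by
    ext x; simp [openPolyhedron]
  rw [this]
  exact isOpen_biInter_finset fun k _ =>
    isOpen_lt continuous_const (continuous_dotProduct_add_const _ _)

lemma convex_openPolyhedron (S : Finset ι) (ν : ι → Fin n → ℝ) (c : ι → ℝ) :
    Convex ℝ (openPolyhedron S ν c) := by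
  intro x hx y hy a b ha hb hab k hk
  have h : ν k ⬝ᵥ (a • x + b • y) + c k
      = a * (ν k ⬝ᵥ x + c k) + b * (ν k ⬝ᵥ y + c k) := by
    rw [dotProduct_add, dotProduct_smul, dotProduct_smul]
    simp only [smul_eq_mul]
    linear_combination (-c k) * hab
  rw [h]
  rcases ha.eq_or_lt with rfl | ha
  · have : b = 1 := by linarith
    subst this
    simpa using hy k hk
  · have := mul_pos ha (hx k hk)
    have := mul_nonneg hb (hy k hk).le
    linarith

/-- Discarding redundant inequalities, each remaining one can be strictly violated
while all the others hold strictly. -/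
lemma exists_irredundant_openPolyhedron [DecidableEq ι] (T : Finset ι) (ν : ι → Fin n → ℝ)
    (c : ι → ℝ) (hν : ∀ k, ν k ≠ 0) :
    ∃ S ⊆ T, openPolyhedron S ν c = openPolyhedron T ν c ∧
      ∀ k ∈ S, ∃ q, ν k ⬝ᵥ q + c k < 0 ∧ q ∈ openPolyhedron (S.erase k) ν c := by
  obtain ⟨S, ⟨hST, hS⟩, hmin⟩ := exists_minimal_of_wellFoundedLT
    (fun S : Finset ι => S ⊆ T ∧ openPolyhedron S ν c = openPolyhedron T ν c) ⟨T, subset_rfl, rfl⟩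
  refine ⟨S, hST, hS, fun k hk => ?_⟩
  have hne : openPolyhedron (S.erase k) ν c ≠ openPolyhedron T ν c := fun h =>
    Finset.notMem_erase k S
      (hmin (y := S.erase k) ⟨(Finset.erase_subset _ _).trans hST, h⟩ (Finset.erase_subset _ _) hk)
  obtain ⟨q, hq, hqk⟩ : ∃ q ∈ openPolyhedron (S.erase k) ν c, ν k ⬝ᵥ q + c k ≤ 0 := by
    by_contra! hcon
    refine hne (hS ▸ Subset.antisymm (fun x hx j hj => ?_) fun x hx j hj =>
      hx j (Finset.mem_of_mem_erase hj))
    by_cases hjk : j = k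
    · exact hjk ▸ hcon x hx
    · exact hx j (Finset.mem_erase.2 ⟨hjk, hj⟩)
  have hcont : Continuous fun s : ℝ => q - s • ν k := by fun_prop
  have hmem : ∀ᶠ s in 𝓝 (0 : ℝ), q - s • ν k ∈ openPolyhedron (S.erase k) ν c :=
    hcont.continuousAt.eventually_mem
      ((isOpen_openPolyhedron _ ν c).mem_nhds (by simpa using hq))
  obtain ⟨s, hs, hs0⟩ := ((hmem.filter_mono nhdsWithin_le_nhds).and
    (self_mem_nhdsWithin : Ioi (0 : ℝ) ∈ 𝓝[>] 0)).exists
  refine ⟨_, ?_, hs⟩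
  have hpos : 0 < ν k ⬝ᵥ ν k := by
    simpa using dotProduct_star_self_pos_iff.2 (hν k)
  have := mul_pos (mem_Ioi.1 hs0) hpos
  rw [dotProduct_sub, dotProduct_smul, smul_eq_mul]
  linarith

/-- A Lipschitz function vanishing on a facet is controlled by the defining function of
that facet. -/
lemma exists_abs_le_mul_of_eq_zero_on_facet [DecidableEq ι] {S : Finset ι} {ν : ι → Fin n → ℝ}
    {c : ι → ℝ} (hbdd : Bornology.IsBounded (openPolyhedron S ν c)) {k : ι}
    {q : Fin n → ℝ} (hqk : ν k ⬝ᵥ q + c k < 0) (hq : q ∈ openPolyhedron (S.erase k) ν c)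
    {g : (Fin n → ℝ) → ℝ} {L : NNReal} (hg : LipschitzOnWith L g (closure (openPolyhedron S ν c)))
    (hg0 : ∀ x ∈ closure (openPolyhedron S ν c), ν k ⬝ᵥ x + c k = 0 → g x = 0) :
    ∃ C, 0 ≤ C ∧ ∀ x ∈ openPolyhedron S ν c, 0 < ν k ⬝ᵥ x + c k →
      |g x| ≤ C * (ν k ⬝ᵥ x + c k) := by
  obtain ⟨D, hD⟩ := hbdd.subset_closedBall q
  have hδ : 0 < -(ν k ⬝ᵥ q + c k) := by linarith
  refine ⟨L * max D 0 / -(ν k ⬝ᵥ q + c k), by positivity, fun x hx hxk => ?_⟩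
  have hxq : dist x q ≤ max D 0 := (hD hx).trans (le_max_left _ _)
  set a := ν k ⬝ᵥ x + c k with ha
  set δ := -(ν k ⬝ᵥ q + c k) with hδ'
  set t := a / (a + δ) with ht
  have ht0 : 0 < t := by positivity
  have ht1 : t < 1 := by rw [ht, div_lt_one (by positivity)]; linarith
  have htδ : t ≤ a / δ := by rw [ht]; gcongr; linarith
  have hseg : MapsTo (AffineMap.lineMap x q : ℝ → Fin n → ℝ) (Ioo 0 t) (openPolyhedron S ν c) := by
    rintro s ⟨hs0, hst⟩ j hj
    rw [dotProduct_lineMap_add_const]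
    by_cases hjk : j = k
    · subst hjk
      have : s * (a + δ) < a := by rwa [ht, lt_div_iff₀ (by positivity)] at hst
      rw [← ha, show ν j ⬝ᵥ q + c j = -δ by simp [hδ']]
      linarith
    · have h1 := hx j hj
      have h2 := hq j (Finset.mem_erase.2 ⟨hjk, hj⟩)
      have : 0 < 1 - s := by linarith
      positivity
  have hy : (AffineMap.lineMap x q t : Fin n → ℝ) ∈ closure (openPolyhedron S ν c) :=
    map_mem_closure (f := (AffineMap.lineMap x q : ℝ → Fin n → ℝ)) AffineMap.lineMap_continuous
      (by rw [closure_Ioo ht0.ne]; exact ⟨ht0.le, le_rfl⟩) hseg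
  have hy0 : ν k ⬝ᵥ (AffineMap.lineMap x q t : Fin n → ℝ) + c k = 0 := by
    rw [dotProduct_lineMap_add_const, ← ha, show ν k ⬝ᵥ q + c k = -δ by simp [hδ'], ht]
    field_simp
    ring
  have hdist := hg.dist_le_mul _ (subset_closure hx) _ hy
  rw [hg0 _ hy hy0, Real.dist_eq, sub_zero, dist_left_lineMap, Real.norm_of_nonneg ht0.le] at hdist
  calc |g x| ≤ L * (t * dist x q) := hdist
    _ ≤ L * (a / δ * max D 0) := by gcongr
    _ = L * max D 0 / δ * a := by ring


/-- A smooth cutoff supported away from the bounding hyperplanes of a polyhedron, and equal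
to `1` at distance of order `1 / m` from them. -/
noncomputable def facetCutoff (S : Finset ι) (ν : ι → Fin n → ℝ) (c : ι → ℝ) (m : ℕ)
    (x : Fin n → ℝ) : ℝ :=
  ∏ k ∈ S, Real.smoothTransition (m * (ν k ⬝ᵥ x + c k) - 1)

lemma contDiff_facetCutoff_factor (w : Fin n → ℝ) (b : ℝ) (m : ℕ) :
    ContDiff ℝ 1 fun x => Real.smoothTransition (m * (w ⬝ᵥ x + b) - 1) :=
  (Real.smoothTransition.contDiff (n := 1)).comp
    ((contDiff_const.mul (contDiff_dotProduct_add_const w b)).sub contDiff_const)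

lemma contDiff_facetCutoff (S : Finset ι) (ν : ι → Fin n → ℝ) (c : ι → ℝ) (m : ℕ) :
    ContDiff ℝ 1 (facetCutoff S ν c m) :=
  contDiff_prod fun k _ => contDiff_facetCutoff_factor (ν k) (c k) m

lemma abs_facetCutoff_le_one (S : Finset ι) (ν : ι → Fin n → ℝ) (c : ι → ℝ) (m : ℕ)
    (x : Fin n → ℝ) : |facetCutoff S ν c m x| ≤ 1 := by
  rw [facetCutoff, Finset.abs_prod]
  refine Finset.prod_le_one (fun _ _ => abs_nonneg _) fun k _ => ?_
  rw [abs_of_nonneg (Real.smoothTransition.nonneg _)]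
  exact Real.smoothTransition.le_one _

lemma facetCutoff_eventually_eq_zero (S : Finset ι) (ν : ι → Fin n → ℝ) (c : ι → ℝ) (m : ℕ)
    {x : Fin n → ℝ} (hx : x ∉ openPolyhedron S ν c) :
    ∀ᶠ y in 𝓝 x, facetCutoff S ν c m y = 0 := by
  simp only [openPolyhedron, mem_ofPred_eq, not_forall, not_lt] at hx
  obtain ⟨k, hk, hxk⟩ := hx
  have hcont : Continuous fun y : Fin n → ℝ => m * (ν k ⬝ᵥ y + c k) - 1 :=
    (continuous_const.mul (continuous_dotProduct_add_const _ _)).sub continuous_const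
  have hneg : m * (ν k ⬝ᵥ x + c k) - 1 < 0 := by
    have := mul_nonpos_of_nonneg_of_nonpos (Nat.cast_nonneg (α := ℝ) m) hxk
    linarith
  filter_upwards [hcont.continuousAt.eventually_lt continuousAt_const hneg] with y hy
  exact Finset.prod_eq_zero hk (Real.smoothTransition.zero_of_nonpos hy.le)

lemma facetCutoff_eventually_eq_one (S : Finset ι) (ν : ι → Fin n → ℝ) (c : ι → ℝ)
    {x : Fin n → ℝ} (hx : x ∈ openPolyhedron S ν c) :
    ∀ᶠ m : ℕ in atTop, ∀ᶠ y in 𝓝 x, facetCutoff S ν c m y = 1 := by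
  have h : ∀ k ∈ S, ∀ᶠ m : ℕ in atTop, ∀ᶠ y in 𝓝 x,
      Real.smoothTransition (m * (ν k ⬝ᵥ y + c k) - 1) = 1 := by
    intro k hk
    have hlim : Tendsto (fun m : ℕ => (m : ℝ) * (ν k ⬝ᵥ x + c k)) atTop atTop :=
      tendsto_natCast_atTop_atTop.atTop_mul_const (hx k hk)
    filter_upwards [hlim.eventually_gt_atTop 2] with m hm
    have hcont : Continuous fun y : Fin n → ℝ => m * (ν k ⬝ᵥ y + c k) :=
      continuous_const.mul (continuous_dotProduct_add_const _ _)
    filter_upwards [continuousAt_const.eventually_lt hcont.continuousAt hm] with y hy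
    exact Real.smoothTransition.one_of_one_le (by linarith)
  filter_upwards [(Finset.eventually_all S).2 h] with m hm
  filter_upwards [(Finset.eventually_all S).2 hm] with y hy
  exact Finset.prod_eq_one hy

lemma fderiv_facetCutoff_single [DecidableEq ι] (S : Finset ι) (ν : ι → Fin n → ℝ) (c : ι → ℝ)
    (m : ℕ) (x : Fin n → ℝ) (j : Fin n) :
    fderiv ℝ (facetCutoff S ν c m) x (Pi.single j 1) =
      ∑ k ∈ S, (∏ l ∈ S.erase k, Real.smoothTransition (m * (ν l ⬝ᵥ x + c l) - 1)) *
        (deriv Real.smoothTransition (m * (ν k ⬝ᵥ x + c k) - 1) * (m * ν k j)) := by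
  have hd : ∀ k ∈ S, HasFDerivAt (fun x => Real.smoothTransition (m * (ν k ⬝ᵥ x + c k) - 1))
      (deriv Real.smoothTransition (m * (ν k ⬝ᵥ x + c k) - 1) •
        ((m : ℝ) • fderiv ℝ (fun x : Fin n → ℝ => ν k ⬝ᵥ x + c k) x)) x := fun k _ =>
    (((Real.smoothTransition.contDiff (n := 1)).differentiable
      one_ne_zero).differentiableAt.hasDerivAt).comp_hasFDerivAt x
      (((((contDiff_dotProduct_add_const (m := 1) (ν k) (c k)).differentiable
        one_ne_zero).differentiableAt.hasFDerivAt).const_mul (m : ℝ)).sub_const 1)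
  have h : HasFDerivAt (facetCutoff S ν c m) _ x := HasFDerivAt.finsetProd hd
  rw [h.fderiv]
  simp only [_root_.sum_apply, _root_.smul_apply, smul_eq_mul,
    fderiv_dotProduct_add_const_single]

/-- Along a field tangent to the facets to first order, the derivatives of the cutoffs are
bounded uniformly in the cutoff parameter. -/
lemma exists_abs_sum_fderiv_facetCutoff_mul_le [DecidableEq ι] (S : Finset ι)
    (ν : ι → Fin n → ℝ) (c : ι → ℝ) {C : ℝ} (hC : 0 ≤ C) :
    ∃ B, ∀ (m : ℕ), ∀ x ∈ openPolyhedron S ν c, ∀ v : Fin n → ℝ,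
      (∀ k ∈ S, |ν k ⬝ᵥ v| ≤ C * (ν k ⬝ᵥ x + c k)) →
      |∑ j, fderiv ℝ (facetCutoff S ν c m) x (Pi.single j 1) * v j| ≤ B := by
  obtain ⟨M, hM⟩ := (isCompact_Icc (a := (-1 : ℝ)) (b := 1)).exists_bound_of_continuousOn
    ((Real.smoothTransition.contDiff (n := 1)).continuous_deriv le_rfl).continuousOn
  have hM0 : 0 ≤ M := (norm_nonneg _).trans (hM 0 (by simp))
  refine ⟨∑ k ∈ S, M * (2 * C), fun m x hx v hv => ?_⟩
  have hsum : ∑ j, fderiv ℝ (facetCutoff S ν c m) x (Pi.single j 1) * v j =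
      ∑ k ∈ S, (∏ l ∈ S.erase k, Real.smoothTransition (m * (ν l ⬝ᵥ x + c l) - 1)) *
        (deriv Real.smoothTransition (m * (ν k ⬝ᵥ x + c k) - 1) * (m * (ν k ⬝ᵥ v))) := by
    simp only [fderiv_facetCutoff_single, Finset.sum_mul, dotProduct, Finset.mul_sum]
    rw [Finset.sum_comm]
    refine Finset.sum_congr rfl fun k _ => Finset.sum_congr rfl fun j _ => ?_
    ring
  rw [hsum]
  refine (Finset.abs_sum_le_sum_abs _ _).trans (Finset.sum_le_sum fun k hk => ?_)
  rw [abs_mul]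
  refine (mul_le_of_le_one_left (abs_nonneg _) (abs_facetCutoff_le_one (S.erase k) ν c m x)).trans ?_
  set a := ν k ⬝ᵥ x + c k with ha
  have ha0 : 0 < a := hx k hk
  rcases le_or_gt (m * a - 1) 1 with h1 | h1
  · have hma : 0 ≤ m * a := by positivity
    have hd := hM (m * a - 1) ⟨by linarith, h1⟩
    rw [Real.norm_eq_abs] at hd
    rw [abs_mul, abs_mul, Nat.abs_cast]
    have h2 : m * |ν k ⬝ᵥ v| ≤ 2 * C :=
      calc m * |ν k ⬝ᵥ v| ≤ m * (C * a) := by gcongr; exact hv k hk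
        _ = m * a * C := by ring
        _ ≤ 2 * C := by gcongr; linarith
    exact mul_le_mul hd h2 (by positivity) hM0
  · have : deriv Real.smoothTransition (m * a - 1) = 0 := by
      have he : Real.smoothTransition =ᶠ[𝓝 (m * a - 1)] fun _ => 1 := by
        filter_upwards [lt_mem_nhds h1] with y hy
        exact Real.smoothTransition.one_of_one_le hy.le
      rw [he.deriv_eq, deriv_const]
    rw [this]
    simp only [zero_mul, abs_zero]
    positivity

lemma integral_fderiv_eq_zero_of_hasCompactSupport {g : (Fin n → ℝ) → ℝ} (hg : ContDiff ℝ 1 g)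
    (hc : HasCompactSupport g) (v : Fin n → ℝ) : ∫ x, fderiv ℝ g x v = 0 := by
  have hint : Integrable fun x => fderiv ℝ g x v :=
    ((hg.continuous_fderiv one_ne_zero).clm_apply continuous_const).integrable_of_hasCompactSupport
      (hc.fderiv_apply ℝ v)
  have := integral_mul_fderiv_eq_neg_fderiv_mul_of_integrable (μ := volume) (𝕜 := ℝ)
    (f := fun _ : Fin n → ℝ => (1 : ℝ)) (g := g) (v := v) (by simp) (by simpa using hint)
    (by simpa using hg.continuous.integrable_of_hasCompactSupport hc) (by simp)
    (fun x _ => hg.differentiable one_ne_zero x)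
  simpa using this

/-- The divergence theorem on a bounded open polyhedron, for a field whose normal components
vanish to first order at the facets. -/
lemma setIntegral_divergence_eq_zero_of_normal_le [DecidableEq ι] {S : Finset ι}
    {ν : ι → Fin n → ℝ} {c : ι → ℝ} (hbdd : Bornology.IsBounded (openPolyhedron S ν c))
    {V : Fin n → (Fin n → ℝ) → ℝ} (hV : ∀ j, ContDiffOn ℝ 1 (V j) (openPolyhedron S ν c))
    {C : ℝ} (hC : 0 ≤ C)
    (hnormal : ∀ x ∈ openPolyhedron S ν c, ∀ k ∈ S,
      |ν k ⬝ᵥ (fun j => V j x)| ≤ C * (ν k ⬝ᵥ x + c k))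
    (hint : IntegrableOn (fun x => ∑ j, fderiv ℝ (V j) x (Pi.single j 1))
      (openPolyhedron S ν c)) :
    ∫ x in openPolyhedron S ν c, ∑ j, fderiv ℝ (V j) x (Pi.single j 1) = 0 := by
  set P := openPolyhedron S ν c with hPdef
  have hPo : IsOpen P := isOpen_openPolyhedron S ν c
  have hzero : ∀ (m : ℕ) j, ∀ x ∉ P, (fun y => facetCutoff S ν c m y * V j y) =ᶠ[𝓝 x] fun _ => 0 := by
    intro m j x hx
    filter_upwards [facetCutoff_eventually_eq_zero S ν c m hx] with y hy
    rw [hy, zero_mul]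
  have hcd : ∀ (m : ℕ) j, ContDiff ℝ 1 fun y => facetCutoff S ν c m y * V j y := by
    refine fun m j => contDiff_iff_contDiffAt.2 fun x => ?_
    by_cases hx : x ∈ P
    · exact (contDiff_facetCutoff S ν c m).contDiffAt.mul
        ((hV j).contDiffAt (hPo.mem_nhds hx))
    · exact contDiffAt_const.congr_of_eventuallyEq (hzero m j x hx)
  have hcs : ∀ (m : ℕ) j, HasCompactSupport fun y => facetCutoff S ν c m y * V j y := by
    refine fun m j => HasCompactSupport.of_support_subset_isCompact hbdd.isCompact_closure ?_
    refine fun x hx => subset_closure (by_contra fun hxP => hx (hzero m j x hxP).self_of_nhds)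
  set A : ℕ → (Fin n → ℝ) → ℝ := fun m x =>
    ∑ j, fderiv ℝ (fun y => facetCutoff S ν c m y * V j y) x (Pi.single j 1) with hA
  have hcontA : ∀ m, Continuous (A m) := fun m => continuous_finsetSum _ fun j _ =>
    ((hcd m j).continuous_fderiv one_ne_zero).clm_apply continuous_const
  have hA0 : ∀ m, ∫ x in P, A m x = 0 := by
    intro m
    rw [setIntegral_eq_integral_of_forall_compl_eq_zero]
    · rw [integral_finsetSum]
      · exact Finset.sum_eq_zero fun j _ =>
          integral_fderiv_eq_zero_of_hasCompactSupport (hcd m j) (hcs m j) _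
      · exact fun j _ => (((hcd m j).continuous_fderiv one_ne_zero).clm_apply
          continuous_const).integrable_of_hasCompactSupport ((hcs m j).fderiv_apply ℝ _)
    · refine fun x hx => Finset.sum_eq_zero fun j _ => ?_
      rw [(hzero m j x hx).fderiv_eq]
      simp
  have hAP : ∀ (m : ℕ), ∀ x ∈ P, A m x =
      facetCutoff S ν c m x * ∑ j, fderiv ℝ (V j) x (Pi.single j 1)
        + ∑ j, fderiv ℝ (facetCutoff S ν c m) x (Pi.single j 1) * V j x := by
    intro m x hx
    rw [hA, Finset.mul_sum, ← Finset.sum_add_distrib]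
    refine Finset.sum_congr rfl fun j _ => ?_
    rw [fderiv_fun_mul ((contDiff_facetCutoff S ν c m).differentiable one_ne_zero x)
      (((hV j).contDiffAt (hPo.mem_nhds hx)).differentiableAt one_ne_zero)]
    simp [mul_comm]
  obtain ⟨B, hB⟩ := exists_abs_sum_fderiv_facetCutoff_mul_le S ν c hC
  have hfin : IsFiniteMeasure (volume.restrict P) :=
    isFiniteMeasure_restrict.2 hbdd.measure_lt_top.ne
  have hlim : Tendsto (fun m => ∫ x in P, A m x) atTop
      (𝓝 (∫ x in P, ∑ j, fderiv ℝ (V j) x (Pi.single j 1))) := by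
    refine tendsto_integral_of_dominated_convergence
      (fun x => ‖∑ j, fderiv ℝ (V j) x (Pi.single j 1)‖ + B)
      (fun m => (hcontA m).aestronglyMeasurable) (hint.norm.add (integrable_const B)) ?_ ?_
    · refine fun m => (ae_restrict_iff' hPo.measurableSet).2 (.of_forall fun x hx => ?_)
      rw [hAP m x hx]
      refine (norm_add_le _ _).trans (add_le_add ?_ (hB m x hx _ (hnormal x hx)))
      rw [norm_mul]
      exact mul_le_of_le_one_left (norm_nonneg _) (abs_facetCutoff_le_one S ν c m x)
    · refine (ae_restrict_iff' hPo.measurableSet).2 (.of_forall fun x hx => ?_)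
      refine tendsto_const_nhds.congr' ?_
      filter_upwards [facetCutoff_eventually_eq_one S ν c hx] with m hm
      have h1 : facetCutoff S ν c m =ᶠ[𝓝 x] fun _ => 1 := hm
      rw [hAP m x hx, h1.fderiv_eq, h1.self_of_nhds]
      simp
  simp only [hA0] at hlim
  exact tendsto_nhds_unique hlim tendsto_const_nhds

lemma uniqueDiffOn_closure_of_convex {P : Set (Fin n → ℝ)} (hPo : IsOpen P) (hPc : Convex ℝ P)
    (hne : P.Nonempty) : UniqueDiffOn ℝ (closure P) :=
  uniqueDiffOn_convex hPc.closure (hne.mono (hPo.subset_interior_iff.2 subset_closure))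

lemma fderivWithin_closure_eq {P : Set (Fin n → ℝ)} (hPo : IsOpen P) (g : (Fin n → ℝ) → ℝ)
    {x : Fin n → ℝ} (hx : x ∈ P) : fderivWithin ℝ g (closure P) x = fderiv ℝ g x :=
  fderivWithin_of_mem_nhds (mem_of_superset (hPo.mem_nhds hx) subset_closure)

lemma contDiffOn_fderivWithin_closure_apply {P : Set (Fin n → ℝ)} (hPo : IsOpen P)
    (hPc : Convex ℝ P) (hne : P.Nonempty) {g : (Fin n → ℝ) → ℝ} {m k : WithTop ℕ∞}
    (hg : ContDiffOn ℝ k g (closure P)) (hmk : m + 1 ≤ k) (v : Fin n → ℝ) :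
    ContDiffOn ℝ m (fun x => fderivWithin ℝ g (closure P) x v) (closure P) :=
  (hg.fderivWithin (uniqueDiffOn_closure_of_convex hPo hPc hne) hmk).clm_apply contDiffOn_const

lemma integrableOn_of_continuousOn_closure {P : Set (Fin n → ℝ)}
    (hbdd : Bornology.IsBounded P) {g : (Fin n → ℝ) → ℝ} (hg : ContinuousOn g (closure P)) :
    IntegrableOn g P :=
  (hg.integrableOn_compact hbdd.isCompact_closure).mono_set subset_closure

/-- The divergence theorem on a bounded open polyhedron, for a `C¹` field on its closure
which is tangent to all facets. -/
lemma setIntegral_divergence_eq_zero_of_tangent {T : Finset ι} {ν : ι → Fin n → ℝ} {c : ι → ℝ}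
    (hν : ∀ k, ν k ≠ 0) (hbdd : Bornology.IsBounded (openPolyhedron T ν c))
    (hne : (openPolyhedron T ν c).Nonempty) {V : Fin n → (Fin n → ℝ) → ℝ}
    (hV : ∀ j, ContDiffOn ℝ 1 (V j) (closure (openPolyhedron T ν c)))
    (htan : ∀ k ∈ T, ∀ x ∈ closure (openPolyhedron T ν c), ν k ⬝ᵥ x + c k = 0 →
      ν k ⬝ᵥ (fun j => V j x) = 0) :
    ∫ x in openPolyhedron T ν c, ∑ j, fderiv ℝ (V j) x (Pi.single j 1) = 0 := by
  classical
  obtain ⟨S, hST, hS, hirr⟩ := exists_irredundant_openPolyhedron T ν c hν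
  rw [← hS] at hbdd hne hV htan ⊢
  have hPo := isOpen_openPolyhedron S ν c
  have hPc := convex_openPolyhedron S ν c
  have hbound : ∀ k ∈ S, ∃ C, 0 ≤ C ∧ ∀ x ∈ openPolyhedron S ν c, 0 < ν k ⬝ᵥ x + c k →
      |ν k ⬝ᵥ (fun j => V j x)| ≤ C * (ν k ⬝ᵥ x + c k) := by
    intro k hk
    obtain ⟨q, hqk, hq⟩ := hirr k hk
    have hcd : ContDiffOn ℝ 1 (fun x => ν k ⬝ᵥ (fun j => V j x))
        (closure (openPolyhedron S ν c)) :=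
      ContDiffOn.sum fun j _ => contDiffOn_const.mul (hV j)
    obtain ⟨L, hL⟩ := LocallyLipschitzOn.exists_lipschitzOnWith_of_compact
      hbdd.isCompact_closure (hcd.locallyLipschitzOn hPc.closure)
    exact exists_abs_le_mul_of_eq_zero_on_facet hbdd hqk hq hL (htan k (hST hk))
  choose! C hC0 hC using hbound
  refine setIntegral_divergence_eq_zero_of_normal_le (C := ∑ k ∈ S, C k) hbdd
    (fun j => (hV j).mono subset_closure) (Finset.sum_nonneg hC0) (fun x hx k hk => ?_) ?_
  · refine (hC k hk x hx (hx k hk)).trans ?_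
    exact mul_le_mul_of_nonneg_right (Finset.single_le_sum hC0 hk) (hx k hk).le
  · have hcont : ContinuousOn (fun x => ∑ j, fderivWithin ℝ (V j)
        (closure (openPolyhedron S ν c)) x (Pi.single j 1)) (closure (openPolyhedron S ν c)) :=
      continuousOn_finsetSum _ fun j _ => (contDiffOn_fderivWithin_closure_apply hPo hPc hne
        (hV j) (m := 0) (by simp) _).continuousOn
    refine (integrableOn_of_continuousOn_closure hbdd hcont).congr_fun (fun x hx => ?_)
      hPo.measurableSet
    exact Finset.sum_congr rfl fun j _ => by rw [fderivWithin_closure_eq hPo _ hx]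

end Polytope

/-- Let `u` be a smooth strictly convex function on a labelled polytope `P ⊂ ℝⁿ` whose
inverse Hessian `H` extends smoothly to `closure P`, is positive definite on `P`, and
satisfies the boundary condition `H(νₖ,·) = 0` on each facet `Fₖ`.  Then the operator
`Δᵘ f = ∑ᵢⱼ (Hᵢⱼ ∂²f/∂xᵢ∂xⱼ + (∂Hᵢⱼ/∂xⱼ)∂f/∂xᵢ)` satisfies the integration-by-parts
identity `∫_P h Δᵘf = -∫_P ∑ Hᵢⱼ f_{,i} h_{,j}` for `f,h ∈ C²(closure P)`; consequently it
is symmetric and its kernel in `C²(closure P)` consists exactly of the constants. -/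
theorem laplacian_integration_by_parts (n d : ℕ)
    (ν : Fin d → Fin n → ℝ) (c : Fin d → ℝ) (hν : ∀ k, ν k ≠ 0)
    (P : Set (Fin n → ℝ))
    (hP : P = {x | ∀ k, 0 < ν k ⬝ᵥ x + c k})
    (hbdd : Bornology.IsBounded P) (hne : P.Nonempty)
    (hsimple : ∀ x ∈ closure P, ({k | ν k ⬝ᵥ x + c k = 0} : Set (Fin d)).ncard ≤ n)
    (F : Fin d → Set (Fin n → ℝ))
    (hF : ∀ k, F k = {x ∈ closure P | ν k ⬝ᵥ x + c k = 0})
    (u : (Fin n → ℝ) → ℝ)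
    (hu : ContDiffOn ℝ (⊤ : ℕ∞) u P) (huconv : StrictConvexOn ℝ P u)
    (H : (Fin n → ℝ) → Fin n → Fin n → ℝ)
    (hHsmooth : ∀ i j, ContDiff ℝ (⊤ : ℕ∞) (fun x => H x i j))
    (hHinv : ∀ x ∈ P, (Matrix.of fun i j => H x i j) *
      (Matrix.of fun i j =>
        fderiv ℝ (fun y => fderiv ℝ u y (Pi.single j 1)) x (Pi.single i 1)) = 1)
    (hHpos : ∀ x ∈ P, (Matrix.of fun i j => H x i j).PosDef)
    (hHbdry : ∀ k, ∀ x ∈ F k, (Matrix.of fun i j => H x i j).mulVec (ν k) = 0)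
    (Δu : ((Fin n → ℝ) → ℝ) → (Fin n → ℝ) → ℝ)
    (hΔu : ∀ f x, Δu f x = ∑ i, ∑ j,
      (H x i j * fderiv ℝ (fun y => fderiv ℝ f y (Pi.single j 1)) x (Pi.single i 1)
        + fderiv ℝ (fun y => H y i j) x (Pi.single j 1) * fderiv ℝ f x (Pi.single i 1))) :
    (∀ f h : (Fin n → ℝ) → ℝ,
      ContDiffOn ℝ 2 f (closure P) → ContDiffOn ℝ 2 h (closure P) →
      (∫ x in P, h x * Δu f x) =
        -∫ x in P, ∑ i, ∑ j,
          H x i j * fderiv ℝ f x (Pi.single i 1) * fderiv ℝ h x (Pi.single j 1)) ∧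
    (∀ f h : (Fin n → ℝ) → ℝ,
      ContDiffOn ℝ 2 f (closure P) → ContDiffOn ℝ 2 h (closure P) →
      (∫ x in P, h x * Δu f x) = ∫ x in P, f x * Δu h x) ∧
    (∀ f : (Fin n → ℝ) → ℝ, ContDiffOn ℝ 2 f (closure P) →
      ((∀ x ∈ P, Δu f x = 0) ↔ ∃ c₀ : ℝ, ∀ x ∈ closure P, f x = c₀)) := by
  classical
  have hPpoly : P = openPolyhedron Finset.univ ν c := by
    rw [hP]; ext x; simp [openPolyhedron]
  have hPo : IsOpen P := hPpoly ▸ isOpen_openPolyhedron _ ν c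
  have hPc : Convex ℝ P := hPpoly ▸ convex_openPolyhedron _ ν c
  have hsub : P ⊆ closure P := subset_closure
  have hsymm : ∀ x ∈ P, ∀ i j, H x i j = H x j i := fun x hx i j => by
    simpa using (hHpos x hx).isHermitian.apply j i
  have hd : ∀ f : (Fin n → ℝ) → ℝ, ContDiffOn ℝ 2 f (closure P) → ∀ v,
      ContDiffOn ℝ 1 (fun x => fderivWithin ℝ f (closure P) x v) (closure P) := fun f hf v =>
    contDiffOn_fderivWithin_closure_apply hPo hPc hne hf (by norm_num) v
  have hdd : ∀ f : (Fin n → ℝ) → ℝ, ContDiffOn ℝ 2 f (closure P) → ∀ v w, ContinuousOn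
      (fun x => fderivWithin ℝ (fun y => fderivWithin ℝ f (closure P) y v) (closure P) x w)
      (closure P) := fun f hf v w =>
    (contDiffOn_fderivWithin_closure_apply hPo hPc hne (hd f hf v) (m := 0) (by simp) w).continuousOn
  have hloc : ∀ (f : (Fin n → ℝ) → ℝ) (v : Fin n → ℝ), ∀ x ∈ P,
      (fun y => fderivWithin ℝ f (closure P) y v) =ᶠ[nhds x] fun y => fderiv ℝ f y v := by
    intro f v x hx
    filter_upwards [hPo.mem_nhds hx] with y hy
    rw [fderivWithin_closure_eq hPo f hy]
  have hdiff : ∀ g : (Fin n → ℝ) → ℝ, ∀ k : WithTop ℕ∞, k ≠ 0 → ContDiffOn ℝ k g (closure P) →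
      ∀ x ∈ P, DifferentiableAt ℝ g x := fun g k hk hg x hx =>
    (hg.contDiffAt (Filter.mem_of_superset (hPo.mem_nhds hx) hsub)).differentiableAt hk
  have hHc : ∀ i j, Continuous fun x => H x i j := fun i j => (hHsmooth i j).continuous
  have hintL : ∀ f h : (Fin n → ℝ) → ℝ,
      ContDiffOn ℝ 2 f (closure P) → ContDiffOn ℝ 2 h (closure P) →
      IntegrableOn (fun x => h x * Δu f x) P := by
    intro f h hf hh
    have hcont : ContinuousOn (fun x => h x * ∑ i, ∑ j,
        (H x i j * fderivWithin ℝ (fun y => fderivWithin ℝ f (closure P) y (Pi.single j 1))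
            (closure P) x (Pi.single i 1)
          + fderiv ℝ (fun y => H y i j) x (Pi.single j 1) *
            fderivWithin ℝ f (closure P) x (Pi.single i 1))) (closure P) := by
      refine hh.continuousOn.mul (continuousOn_finsetSum _ fun i _ =>
        continuousOn_finsetSum _ fun j _ => ((hHc i j).continuousOn.mul (hdd f hf _ _)).add
          (ContinuousOn.mul ?_ (hd f hf _).continuousOn))
      exact (((hHsmooth i j).continuous_fderiv (by simp)).clm_apply
        continuous_const).continuousOn
    refine (integrableOn_of_continuousOn_closure hbdd hcont).congr_fun (fun x hx => ?_)
      hPo.measurableSet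
    simp only [hΔu, fderivWithin_closure_eq hPo _ hx, (hloc f _ x hx).fderiv_eq]
  have hcontR : ∀ f h : (Fin n → ℝ) → ℝ,
      ContDiffOn ℝ 2 f (closure P) → ContDiffOn ℝ 2 h (closure P) →
      ContinuousOn (fun x => ∑ i, ∑ j, H x i j *
        fderivWithin ℝ f (closure P) x (Pi.single i 1) *
        fderivWithin ℝ h (closure P) x (Pi.single j 1)) (closure P) :=
    fun f h hf hh => continuousOn_finsetSum _ fun i _ => continuousOn_finsetSum _ fun j _ =>
      ((hHc i j).continuousOn.mul (hd f hf _).continuousOn).mul (hd h hh _).continuousOn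
  have hEqR : ∀ f h : (Fin n → ℝ) → ℝ, Set.EqOn (fun x => ∑ i, ∑ j, H x i j *
        fderivWithin ℝ f (closure P) x (Pi.single i 1) *
        fderivWithin ℝ h (closure P) x (Pi.single j 1))
      (fun x => ∑ i, ∑ j, H x i j * fderiv ℝ f x (Pi.single i 1) *
        fderiv ℝ h x (Pi.single j 1)) P := fun f h x hx => by
    simp only [fderivWithin_closure_eq hPo _ hx]
  have hintR : ∀ f h : (Fin n → ℝ) → ℝ,
      ContDiffOn ℝ 2 f (closure P) → ContDiffOn ℝ 2 h (closure P) →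
      IntegrableOn (fun x => ∑ i, ∑ j, H x i j * fderiv ℝ f x (Pi.single i 1) *
        fderiv ℝ h x (Pi.single j 1)) P := fun f h hf hh =>
    (integrableOn_of_continuousOn_closure hbdd (hcontR f h hf hh)).congr_fun (hEqR f h)
      hPo.measurableSet
  have green : ∀ f h : (Fin n → ℝ) → ℝ,
      ContDiffOn ℝ 2 f (closure P) → ContDiffOn ℝ 2 h (closure P) →
      (∫ x in P, h x * Δu f x) =
        -∫ x in P, ∑ i, ∑ j,
          H x i j * fderiv ℝ f x (Pi.single i 1) * fderiv ℝ h x (Pi.single j 1) := by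
    intro f h hf hh
    set V : Fin n → (Fin n → ℝ) → ℝ := fun j x =>
      h x * ∑ i, H x i j * fderivWithin ℝ f (closure P) x (Pi.single i 1) with hVdef
    have hV : ∀ j, ContDiffOn ℝ 1 (V j) (closure P) := fun j =>
      (hh.of_le (by norm_num)).mul (ContDiffOn.sum fun i _ =>
        ((hHsmooth i j).of_le (by simp)).contDiffOn.mul (hd f hf _))
    have htan : ∀ k, ∀ x ∈ closure P, ν k ⬝ᵥ x + c k = 0 → ν k ⬝ᵥ (fun j => V j x) = 0 := by
      intro k x hx hxk
      have hb := hHbdry k x (by rw [hF]; exact ⟨hx, hxk⟩)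
      have : ν k ⬝ᵥ (fun j => V j x) = h x * ∑ i,
          fderivWithin ℝ f (closure P) x (Pi.single i 1) *
            ((Matrix.of fun i j => H x i j).mulVec (ν k)) i := by
        simp only [hVdef, dotProduct, Matrix.mulVec, Matrix.of_apply, Finset.mul_sum]
        rw [Finset.sum_comm]
        refine Finset.sum_congr rfl fun i _ => Finset.sum_congr rfl fun j _ => ?_
        ring
      rw [this, hb]
      simp
    have hdiv : ∫ x in P, ∑ j, fderiv ℝ (V j) x (Pi.single j 1) = 0 := by
      subst hPpoly
      exact setIntegral_divergence_eq_zero_of_tangent hν hbdd hne hV fun k _ => htan k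
    have hpt : ∀ x ∈ P, ∑ j, fderiv ℝ (V j) x (Pi.single j 1) = h x * Δu f x +
        ∑ i, ∑ j, H x i j * fderiv ℝ f x (Pi.single i 1) * fderiv ℝ h x (Pi.single j 1) := by
      intro x hx
      have hterm : ∀ i j, DifferentiableAt ℝ
          (fun y => H y i j * fderivWithin ℝ f (closure P) y (Pi.single i 1)) x := fun i j =>
        ((hHsmooth i j).differentiable (by simp) x).mul
          (hdiff _ 1 one_ne_zero (hd f hf _) x hx)
      have hVj : ∀ j, fderiv ℝ (V j) x (Pi.single j 1) = ∑ i,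
          (h x * (H x i j *
              fderiv ℝ (fun y => fderiv ℝ f y (Pi.single i 1)) x (Pi.single j 1)
            + fderiv ℝ (fun y => H y i j) x (Pi.single j 1) * fderiv ℝ f x (Pi.single i 1))
          + H x i j * fderiv ℝ f x (Pi.single i 1) * fderiv ℝ h x (Pi.single j 1)) := by
        intro j
        rw [hVdef, fderiv_fun_mul (hdiff h 2 two_ne_zero hh x hx)
          (DifferentiableAt.fun_sum fun i _ => hterm i j), fderiv_fun_sum fun i _ => hterm i j]
        simp only [_root_.add_apply, _root_.smul_apply,
          _root_.sum_apply, smul_eq_mul, Finset.mul_sum, Finset.sum_mul]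
        rw [← Finset.sum_add_distrib]
        refine Finset.sum_congr rfl fun i _ => ?_
        rw [fderiv_fun_mul ((hHsmooth i j).differentiable (by simp) x)
          (hdiff _ 1 one_ne_zero (hd f hf _) x hx), (hloc f _ x hx).fderiv_eq,
          fderivWithin_closure_eq hPo f hx]
        simp only [_root_.add_apply, _root_.smul_apply, smul_eq_mul]
        ring
      have hswap : ∑ i, ∑ j, H x i j *
            fderiv ℝ (fun y => fderiv ℝ f y (Pi.single i 1)) x (Pi.single j 1) =
          ∑ i, ∑ j, H x i j *
            fderiv ℝ (fun y => fderiv ℝ f y (Pi.single j 1)) x (Pi.single i 1) := by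
        rw [Finset.sum_comm]
        exact Finset.sum_congr rfl fun i _ => Finset.sum_congr rfl fun j _ => by
          rw [hsymm x hx]
      simp only [hVj]
      rw [Finset.sum_comm]
      simp only [hΔu, Finset.sum_add_distrib, ← Finset.mul_sum]
      rw [hswap]
    rw [setIntegral_congr_fun hPo.measurableSet hpt,
      integral_add (hintL f h hf hh) (hintR f h hf hh)] at hdiv
    linarith
  refine ⟨green, fun f h hf hh => ?_, fun f hf => ⟨fun hker => ?_, ?_⟩⟩
  · rw [green f h hf hh, green h f hh hf]
    congr 1
    refine setIntegral_congr_fun hPo.measurableSet fun x hx => ?_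
    rw [Finset.sum_comm]
    refine Finset.sum_congr rfl fun i _ => Finset.sum_congr rfl fun j _ => ?_
    rw [hsymm x hx]
    ring
  · have hquad : ∀ x, ∑ i, ∑ j, H x i j * fderiv ℝ f x (Pi.single i 1) *
          fderiv ℝ f x (Pi.single j 1) = star (fun i => fderiv ℝ f x (Pi.single i 1)) ⬝ᵥ
        ((Matrix.of fun i j => H x i j) *ᵥ fun i => fderiv ℝ f x (Pi.single i 1)) := by
      intro x
      simp only [dotProduct, Matrix.mulVec, Matrix.of_apply, Pi.star_apply, star_trivial,
        Finset.mul_sum]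
      refine Finset.sum_congr rfl fun i _ => Finset.sum_congr rfl fun j _ => ?_
      ring
    have hI : ∫ x in P, ∑ i, ∑ j, H x i j * fderiv ℝ f x (Pi.single i 1) *
        fderiv ℝ f x (Pi.single j 1) = 0 := by
      rw [← neg_eq_zero, ← green f f hf hf]
      exact setIntegral_eq_zero_of_forall_eq_zero fun x hx => by rw [hker x hx, mul_zero]
    have hae := (setIntegral_eq_zero_iff_of_nonneg_ae
      ((ae_restrict_iff' hPo.measurableSet).2 (.of_forall fun x hx => by
        simp only [Pi.zero_apply, hquad]
        exact (hHpos x hx).posSemidef.dotProduct_mulVec_nonneg _))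
      (hintR f f hf hf)).1 hI
    have hzero := Measure.eqOn_open_of_ae_eq hae hPo
      (((hcontR f f hf hf).mono hsub).congr fun x hx => (hEqR f f hx).symm) continuousOn_const
    have hgrad : Set.EqOn (fderiv ℝ f) 0 P := by
      intro x hx
      have hvec : (fun i => fderiv ℝ f x (Pi.single i 1)) = 0 := by
        by_contra hcon
        have hpos := (hHpos x hx).dotProduct_mulVec_pos hcon
        rw [← hquad] at hpos
        exact hpos.ne' (hzero hx)
      refine ContinuousLinearMap.coe_injective (LinearMap.pi_ext' fun i => ?_)
      ext
      simpa using congrFun hvec i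
    obtain ⟨a, ha⟩ := hPo.exists_is_const_of_fderiv_eq_zero hPc.isPreconnected
      (fun x hx => (hdiff f 2 two_ne_zero hf x hx).differentiableWithinAt) hgrad
    exact ⟨a, Set.EqOn.of_subset_closure (s := P) (g := fun _ => a) (fun x hx => ha x hx)
      hf.continuousOn continuousOn_const hsub subset_rfl⟩
  · rintro ⟨a, ha⟩ x hx
    have hf0 : ∀ y ∈ P, fderiv ℝ f y = 0 := by
      intro y hy
      have : f =ᶠ[nhds y] fun _ => a := by
        filter_upwards [hPo.mem_nhds hy] with z hz using ha z (hsub hz)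
      rw [this.fderiv_eq]
      simp
    have hf1 : ∀ v : Fin n → ℝ, fderiv ℝ (fun y => fderiv ℝ f y v) x = 0 := by
      intro v
      have : (fun y => fderiv ℝ f y v) =ᶠ[nhds x] fun _ => 0 := by
        filter_upwards [hPo.mem_nhds hx] with z hz
        rw [hf0 z hz]
        rfl
      rw [this.fderiv_eq]
      simp
    rw [hΔu]
    simp [hf0 x hx, hf1]
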